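/- For every r ∈ R there is a unique group endomorphism φ_r of the derived group G_ρ satisfying φ_r(g^v) = g^{r·v} for all g ∈ G and v ∈ V; moreover φ_{rs} = φ_r ∘ φ_s for all r, s ∈ R and φ_1 is the identity (so G_ρ is an R-group, R regarded as a multiplicative monoid). -/

import Mathlib

/-- The defining relators of Crowell's derived group of the permutation
representation associated to a right action `act` of `G` on `Γ`:
`(γ, g*h) * ((γ, g) * (γ·g, h))⁻¹` for `g, h ∈ G` and `γ ∈ Γ`. -/
def derivedRels {Γ : Type*} {G : Type*} [Group G] (act : Γ → G → Γ) :
    Set (FreeGroup (Γ × G)) :=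
  {r | ∃ (γ : Γ) (g h : G),
    r = FreeGroup.of (γ, g * h) *
      (FreeGroup.of (γ, g) * FreeGroup.of (act γ g, h))⁻¹}

/-- Crowell's derived group `G_ρ`. -/
def DerivedGroup {Γ : Type*} {G : Type*} [Group G] (act : Γ → G → Γ) :=
  PresentedGroup (derivedRels act)

instance {Γ : Type*} {G : Type*} [Group G] (act : Γ → G → Γ) :
    Group (DerivedGroup act) :=
  inferInstanceAs (Group (PresentedGroup (derivedRels act)))

/-- The generator `g^γ` of the derived group. -/
def derivedGen {Γ : Type*} {G : Type*} [Group G] (act : Γ → G → Γ)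
    (γ : Γ) (g : G) : DerivedGroup act :=
  PresentedGroup.of (rels := derivedRels act) (γ, g)

theorem derivedGen_mul {Γ : Type*} {G : Type*} [Group G] (act : Γ → G → Γ)
    (γ : Γ) (g h : G) :
    derivedGen act γ (g * h) = derivedGen act γ g * derivedGen act (act γ g) h :=
  mul_inv_eq_one.mp (PresentedGroup.one_of_mem (rels := derivedRels act) ⟨γ, g, h, rfl⟩)

theorem DerivedGroup.hom_ext {Γ : Type*} {G : Type*} [Group G] {act : Γ → G → Γ}
    {H : Type*} [Group H] {φ ψ : DerivedGroup act →* H}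
    (hφψ : ∀ (g : G) (γ : Γ), φ (derivedGen act γ g) = ψ (derivedGen act γ g)) : φ = ψ :=
  PresentedGroup.ext (rels := derivedRels act) fun x => hφψ x.2 x.1

/-- An equivariant map of `G`-sets induces a homomorphism of derived groups. -/
def DerivedGroup.map {Γ Δ : Type*} {G : Type*} [Group G] {act : Γ → G → Γ}
    {act' : Δ → G → Δ} (f : Γ → Δ) (hf : ∀ (γ : Γ) (g : G), act' (f γ) g = f (act γ g)) :
    DerivedGroup act →* DerivedGroup act' :=
  PresentedGroup.toGroup (rels := derivedRels act)
    (f := fun x : Γ × G => derivedGen act' (f x.1) x.2) (by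
      rintro _ ⟨γ, g, h, rfl⟩
      simp only [map_mul, map_inv, FreeGroup.lift_apply_of]
      rw [derivedGen_mul, hf, mul_inv_cancel])

theorem DerivedGroup.map_derivedGen {Γ Δ : Type*} {G : Type*} [Group G] {act : Γ → G → Γ}
    {act' : Δ → G → Δ} (f : Γ → Δ) (hf : ∀ (γ : Γ) (g : G), act' (f γ) g = f (act γ g))
    (γ : Γ) (g : G) :
    DerivedGroup.map f hf (derivedGen act γ g) = derivedGen act' (f γ) g :=
  PresentedGroup.toGroup.of _

/-- When `G` acts on a left `R`-module `V` by `R`-linear automorphisms, scalar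
multiplication by `r` on coordinates induces a unique endomorphism `φ_r` of the
derived group; moreover `φ_{rs} = φ_r ∘ φ_s` and `φ_1 = id`, so `G_ρ` is an
`R`-group for the multiplicative monoid of `R`. -/
theorem derived_operator_module {R : Type*} [Ring R] {V : Type*} [AddCommGroup V]
    [Module R V] {G : Type*} [Group G]
    (act : V → G → V)
    (act_one : ∀ v : V, act v 1 = v)
    (act_mul : ∀ (v : V) (g h : G), act v (g * h) = act (act v g) h)
    (act_add : ∀ (v w : V) (g : G), act (v + w) g = act v g + act w g)
    (act_smul : ∀ (r : R) (v : V) (g : G), act (r • v) g = r • act v g) :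
    (∀ r : R, ∃! φ : DerivedGroup act →* DerivedGroup act,
      ∀ (g : G) (v : V), φ (derivedGen act v g) = derivedGen act (r • v) g) ∧
    (∀ (r s : R) (φr φs φrs : DerivedGroup act →* DerivedGroup act),
      (∀ (g : G) (v : V), φr (derivedGen act v g) = derivedGen act (r • v) g) →
      (∀ (g : G) (v : V), φs (derivedGen act v g) = derivedGen act (s • v) g) →
      (∀ (g : G) (v : V), φrs (derivedGen act v g) = derivedGen act ((r * s) • v) g) →
      φrs = φr.comp φs) ∧
    (∀ φ : DerivedGroup act →* DerivedGroup act,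
      (∀ (g : G) (v : V), φ (derivedGen act v g) = derivedGen act ((1 : R) • v) g) →
      φ = MonoidHom.id (DerivedGroup act)) := by
  refine ⟨fun r => ⟨DerivedGroup.map (fun v => r • v) (act_smul r), fun g v =>
    DerivedGroup.map_derivedGen _ _ v g, fun ψ hψ => DerivedGroup.hom_ext fun g v => ?_⟩,
    fun r s φr φs φrs hr hs hrs => DerivedGroup.hom_ext fun g v => ?_,
    fun φ hφ => DerivedGroup.hom_ext fun g v => ?_⟩
  · rw [hψ, DerivedGroup.map_derivedGen]
  · rw [MonoidHom.comp_apply, hrs, hs, hr, mul_smul]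
  · rw [hφ, one_smul, MonoidHom.id_apply]
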